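/- Fix a user κ ∈ {1,…,N} with N ≥ 1. Under the product measure on Ω = (Fin N → Fin m) with i.i.d. coordinates of law ρ, the probability of the Half-Duplex Receiver (HDRX) event {r ∈ Ω : r(κ) ∈ {1,…,N}\{κ} and ∀ τ ≠ κ, r(τ) ≠ κ} equals (P_hit − ρ_κ)(1 − ρ_κ)^{N−1}, where P_hit = Σ_{ℓ=1}^N ρ_ℓ. Consequently, the probability that a uniformly chosen user operates in HDRX mode equals (1/N) Σ_{κ=1}^N (P_hit − ρ_κ)(1 − ρ_κ)^{N−1}. -/

import Mathlib

open Finset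

open scoped Classical

/-- Zipf popularity: content `κ` (0-indexed, representing content `κ+1`) has
popularity `(κ+1)^{-γ} / ∑_{η=1}^m η^{-γ}`. -/
noncomputable def zipf (m : ℕ) (γ : ℝ) (κ : Fin m) : ℝ :=
  (((κ : ℕ) : ℝ) + 1) ^ (-γ) / ∑ η : Fin m, (((η : ℕ) : ℝ) + 1) ^ (-γ)

/-- Probability of the event `E` on `Ω = (Fin N → Fin m)` under the product measure in
which each coordinate is i.i.d. with probability mass function `ρ`. -/
noncomputable def prob {N m : ℕ} (ρ : Fin m → ℝ) (E : (Fin N → Fin m) → Prop) : ℝ :=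
  ∑ r : Fin N → Fin m, if E r then ∏ τ : Fin N, ρ (r τ) else 0

lemma prob_forall {N m : ℕ} (ρ : Fin m → ℝ) (A : Fin N → Fin m → Prop) :
    prob ρ (fun r => ∀ τ, A τ (r τ)) = ∏ τ, ∑ x, if A τ x then ρ x else 0 := by
  rw [prob, Fintype.prod_sum]
  exact sum_congr rfl fun r _ => by simp [Finset.prod_ite_zero]

lemma sum_zipf {m : ℕ} (hm : 0 < m) (γ : ℝ) : ∑ x, zipf m γ x = 1 := by
  have : NeZero m := ⟨hm.ne'⟩
  simp only [zipf, ← sum_div]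
  exact div_self (sum_pos (fun _ _ => by positivity) univ_nonempty).ne'

lemma sum_ite_ne {m : ℕ} (ρ : Fin m → ℝ) (a : Fin m) :
    (∑ x, if x ≠ a then ρ x else 0) = ∑ x, ρ x - ρ a := by
  rw [← sum_filter, filter_ne', ← sum_erase_eq_sub (mem_univ a)]

lemma sum_ite_lt {m N : ℕ} (hNm : N ≤ m) (ρ : Fin m → ℝ) :
    (∑ x : Fin m, if (x : ℕ) < N then ρ x else 0) = ∑ ℓ : Fin N, ρ (Fin.castLE hNm ℓ) := by
  rw [← sum_filter]
  refine (sum_bij (fun ℓ _ => Fin.castLE hNm ℓ) (fun ℓ _ => by simp)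
    (fun a _ b _ h => by simpa using h) (fun x hx => ⟨⟨x, by simpa using hx⟩, mem_univ _, rfl⟩)
    fun _ _ => rfl).symm

lemma prob_HDRX_of_sum_eq_one {m N : ℕ} (hNm : N ≤ m) (ρ : Fin m → ℝ) (hρ : ∑ x, ρ x = 1)
    (κ : Fin N) :
    prob ρ (fun r => (((r κ : Fin m) : ℕ) < N ∧ r κ ≠ Fin.castLE hNm κ) ∧
        ∀ τ : Fin N, τ ≠ κ → r τ ≠ Fin.castLE hNm κ)
      = ((∑ ℓ : Fin N, ρ (Fin.castLE hNm ℓ)) - ρ (Fin.castLE hNm κ)) *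
          (1 - ρ (Fin.castLE hNm κ)) ^ (N - 1) := by
  have hE : (fun r : Fin N → Fin m => (((r κ : Fin m) : ℕ) < N ∧ r κ ≠ Fin.castLE hNm κ) ∧
        ∀ τ : Fin N, τ ≠ κ → r τ ≠ Fin.castLE hNm κ) =
      fun r => ∀ τ, (τ = κ → (r τ : ℕ) < N) ∧ r τ ≠ Fin.castLE hNm κ := by
    ext r
    constructor
    · rintro ⟨⟨h₁, h₂⟩, h₃⟩ τ
      by_cases h : τ = κ
      · subst h
        exact ⟨fun _ => h₁, h₂⟩
      · exact ⟨fun h' => absurd h' h, h₃ τ h⟩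
    · exact fun h => ⟨⟨(h κ).1 rfl, (h κ).2⟩, fun τ _ => (h τ).2⟩
  rw [hE, prob_forall ρ fun τ x => (τ = κ → (x : ℕ) < N) ∧ x ≠ Fin.castLE hNm κ,
    ← mul_prod_erase univ _ (mem_univ κ)]
  congr 1
  · have h := sum_ite_ne (fun x : Fin m => if (x : ℕ) < N then ρ x else 0) (Fin.castLE hNm κ)
    rw [sum_ite_lt hNm] at h
    simp only [Fin.val_castLE, κ.isLt, if_true] at h
    rw [← h]
    refine sum_congr rfl fun x _ => ?_
    simp only [true_imp_iff, ite_and]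
    split_ifs <;> rfl
  · rw [prod_congr rfl (g := fun _ => 1 - ρ (Fin.castLE hNm κ))]
    · simp
    · intro τ hτ
      rw [← hρ, ← sum_ite_ne]
      simp [ne_of_mem_erase hτ]

/-- HDRX mode: user `κ`'s requested content is cached by another user, and no other user
requests content `κ`. Its probability is `(P_hit - ρ_κ)(1-ρ_κ)^(N-1)`, and the
probability that a uniformly chosen user operates in HDRX mode is the average. -/
theorem prob_HDRX (m N : ℕ) (γr : ℝ) (hγr : 0 < γr)
    (hN : 1 ≤ N) (hNm : N ≤ m) (ρ : Fin m → ℝ) (hρ : ρ = zipf m γr) (κ : Fin N) :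
    prob ρ (fun r => (((r κ : Fin m) : ℕ) < N ∧ r κ ≠ Fin.castLE hNm κ) ∧
        ∀ τ : Fin N, τ ≠ κ → r τ ≠ Fin.castLE hNm κ)
      = ((∑ ℓ : Fin N, ρ (Fin.castLE hNm ℓ)) - ρ (Fin.castLE hNm κ)) *
          (1 - ρ (Fin.castLE hNm κ)) ^ (N - 1)
    ∧ (1 / (N : ℝ)) * ∑ κ' : Fin N,
        prob ρ (fun r => (((r κ' : Fin m) : ℕ) < N ∧ r κ' ≠ Fin.castLE hNm κ') ∧
          ∀ τ : Fin N, τ ≠ κ' → r τ ≠ Fin.castLE hNm κ')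
      = (1 / (N : ℝ)) * ∑ κ' : Fin N,
          ((∑ ℓ : Fin N, ρ (Fin.castLE hNm ℓ)) - ρ (Fin.castLE hNm κ')) *
            (1 - ρ (Fin.castLE hNm κ')) ^ (N - 1) := by
  have h := prob_HDRX_of_sum_eq_one hNm ρ (hρ ▸ sum_zipf (hN.trans hNm) γr)
  exact ⟨h κ, by simp_rw [h]⟩
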